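/- arXiv:1010.5184 — 2 statements merged into one kernel-verified Lean document; each statement's English description precedes it below -/
import Mathlib

section
/- Let ν ∈ ℂ with Re(ν) > −1 and let f ∈ S_ν([0,∞)). Then the Hankel transform H_ν(f) is rapidly decreasing at infinity: for every nonnegative integer m there is a constant C such that |H_ν(f)(y)| ≤ C·y^{−m} for all y ≥ 1. -/
open MeasureTheory Set

/-- The classical J-Bessel function of complex index `ν`, via its power series
(principal branch of powers). -/
noncomputable def besselJ (ν : ℂ) (x : ℝ) : ℂ :=
  ∑' k : ℕ, ((-1 : ℂ) ^ k * ((x / 2 : ℝ) : ℂ) ^ (ν + 2 * (k : ℂ))) /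
    (Complex.Gamma ((k : ℂ) + 1) * Complex.Gamma ((k : ℂ) + ν + 1))

/-- `g` and all of its derivatives are rapidly decreasing at `+∞`. -/
def RapidlyDecreasing (g : ℝ → ℂ) : Prop :=
  ∀ m n : ℕ, ∃ C : ℝ, ∀ x : ℝ, 1 ≤ x → x ^ m * ‖iteratedDeriv n g x‖ ≤ C

/-- Membership in the Schwartz space `S([0,∞))`: `f` agrees on `[0,∞)` with a smooth
function on `ℝ` all of whose derivatives are rapidly decreasing at `+∞`. -/
def MemSHalf (f : ℝ → ℂ) : Prop :=
  ∃ g : ℝ → ℂ, ContDiff ℝ (⊤ : ℕ∞) g ∧ (∀ x : ℝ, 0 ≤ x → f x = g x) ∧ RapidlyDecreasing g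

/-- Membership in `S_ν([0,∞))`: `f(x) = x^{(ν+1)/2} f₁(x)` on `[0,∞)` for some
`f₁ ∈ S([0,∞))` (principal branch of the complex power). -/
def MemSnu (ν : ℂ) (f : ℝ → ℂ) : Prop :=
  ∃ f₁ : ℝ → ℂ, MemSHalf f₁ ∧ ∀ x : ℝ, 0 ≤ x → f x = (x : ℂ) ^ ((ν + 1) / 2) * f₁ x

/-- The Hankel transform of order `ν`: `H_ν(f)(y) = ∫₀^∞ f(x) √(xy) J_ν(2√(xy)) dx/x`. -/
noncomputable def hankel (ν : ℂ) (f : ℝ → ℂ) (y : ℝ) : ℂ :=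
  ∫ x in Ioi (0 : ℝ), f x * (Real.sqrt (x * y) : ℂ) * besselJ ν (2 * Real.sqrt (x * y)) / (x : ℂ)

open Filter Topology

/-- The power series coefficients of `besselEntire`. -/
noncomputable def besselCoeff (μ : ℂ) (k : ℕ) : ℂ :=
  ((k.factorial : ℂ) * Complex.Gamma ((k : ℂ) + μ + 1))⁻¹

/-- The entire part of the Bessel function: `J_μ(2√t) = t^{μ/2} E_μ(t)` for `t > 0`. -/
noncomputable def besselEntire (μ : ℂ) (t : ℝ) : ℂ :=
  ∑' k : ℕ, besselCoeff μ k * (-(t : ℂ)) ^ k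

lemma natCast_add_add_one_re_pos {μ : ℂ} (hμ : -1 < μ.re) (k : ℕ) :
    0 < ((k : ℂ) + μ + 1).re := by
  have : (0 : ℝ) ≤ k := k.cast_nonneg
  simp only [Complex.add_re, Complex.natCast_re, Complex.one_re]
  linarith

lemma natCast_add_add_one_ne_zero {μ : ℂ} (hμ : -1 < μ.re) (k : ℕ) :
    (k : ℂ) + μ + 1 ≠ 0 := by
  intro h
  have := natCast_add_add_one_re_pos hμ k
  simp [h] at this

lemma besselCoeff_ne_zero {μ : ℂ} (hμ : -1 < μ.re) (k : ℕ) : besselCoeff μ k ≠ 0 :=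
  inv_ne_zero (mul_ne_zero (by exact_mod_cast k.factorial_ne_zero)
    (Complex.Gamma_ne_zero_of_re_pos (natCast_add_add_one_re_pos hμ k)))

lemma succ_mul_besselCoeff_succ (μ : ℂ) (k : ℕ) :
    ((k : ℂ) + 1) * besselCoeff μ (k + 1) = besselCoeff (μ + 1) k := by
  have hk : (k : ℂ) + 1 ≠ 0 := by exact_mod_cast k.succ_ne_zero
  have hG : ((k + 1 : ℕ) : ℂ) + μ + 1 = (k : ℂ) + (μ + 1) + 1 := by push_cast; ring
  rw [besselCoeff, besselCoeff, hG, Nat.factorial_succ]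
  push_cast
  rw [mul_assoc, mul_inv, mul_inv_cancel_left₀ hk]

lemma besselCoeff_eq_mul {μ : ℂ} (hμ : -1 < μ.re) (k : ℕ) :
    besselCoeff μ k = ((k : ℂ) + μ + 1) * besselCoeff (μ + 1) k := by
  have h0 := natCast_add_add_one_ne_zero hμ k
  rw [besselCoeff, besselCoeff, show (k : ℂ) + (μ + 1) + 1 = ((k : ℂ) + μ + 1) + 1 by ring,
    Complex.Gamma_add_one _ h0, mul_left_comm, mul_inv (_ + _ + _),
    mul_inv_cancel_left₀ h0]

lemma summable_besselCoeff_mul_pow {μ : ℂ} (hμ : -1 < μ.re) (z : ℂ) :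
    Summable fun k : ℕ => besselCoeff μ k * z ^ k := by
  rcases eq_or_ne z 0 with rfl | hz
  · refine summable_of_ne_finset_zero (s := {0}) fun k hk => ?_
    rw [zero_pow (by simpa using hk), mul_zero]
  have hne (k : ℕ) : besselCoeff μ k * z ^ k ≠ 0 :=
    mul_ne_zero (besselCoeff_ne_zero hμ k) (pow_ne_zero _ hz)
  refine summable_of_ratio_test_tendsto_lt_one zero_lt_one (Eventually.of_forall hne) ?_
  have hratio (k : ℕ) : ‖besselCoeff μ (k + 1) * z ^ (k + 1)‖ / ‖besselCoeff μ k * z ^ k‖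
      = ‖z‖ / (((k : ℝ) + 1) * ‖(k : ℂ) + μ + 1‖) := by
    have h1 : ‖(k : ℂ) + 1‖ = (k : ℝ) + 1 := by
      rw [← Nat.cast_succ, Complex.norm_natCast]; push_cast; rfl
    have h2 : ‖(k : ℂ) + μ + 1‖ ≠ 0 := norm_ne_zero_iff.mpr (natCast_add_add_one_ne_zero hμ k)
    have h3 : (k : ℝ) + 1 ≠ 0 := by positivity
    have h4 : ‖besselCoeff μ (k + 1)‖ ≠ 0 := norm_ne_zero_iff.mpr (besselCoeff_ne_zero hμ _)
    have h5 : ‖z‖ ≠ 0 := norm_ne_zero_iff.mpr hz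
    rw [besselCoeff_eq_mul hμ k, ← succ_mul_besselCoeff_succ]
    simp only [norm_mul, norm_pow, h1]
    field_simp
    exact pow_succ _ _
  simp_rw [hratio]
  have hlow (k : ℕ) : (k : ℝ) * (μ.re + 1) ≤ ((k : ℝ) + 1) * ‖(k : ℂ) + μ + 1‖ := by
    have h1 : μ.re + 1 ≤ ‖(k : ℂ) + μ + 1‖ := by
      refine le_trans ?_ (Complex.re_le_norm _)
      simp
    have : (0 : ℝ) ≤ k := k.cast_nonneg
    have h2 : 0 ≤ μ.re + 1 := by linarith
    exact mul_le_mul (by linarith) h1 h2 (by linarith)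
  refine Tendsto.div_atTop tendsto_const_nhds (tendsto_atTop_mono hlow ?_)
  exact tendsto_natCast_atTop_atTop.atTop_mul_const (by linarith)

lemma hasDerivAt_besselEntire {μ : ℂ} (hμ : -1 < μ.re) (t : ℝ) :
    HasDerivAt (besselEntire μ) (-besselEntire (μ + 1) t) t := by
  have hμ' : -1 < (μ + 1).re := by simp; linarith
  set R : ℝ := |t| + 1 with hR
  have hR0 : 0 < R := by positivity
  have hderiv (k : ℕ) (s : ℝ) : HasDerivAt (fun x : ℝ => besselCoeff μ k * (-(x : ℂ)) ^ k)
      (besselCoeff μ k * (k * (-(s : ℂ)) ^ (k - 1) * (-1))) s :=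
    ((((hasDerivAt_id s).ofReal_comp.fun_neg).fun_pow k).const_mul _).congr_deriv (by simp)
  have hshift (s : ℝ) (k : ℕ) :
      besselCoeff μ (k + 1) * (((k + 1 : ℕ) : ℂ) * (-(s : ℂ)) ^ (k + 1 - 1) * (-1))
        = -(besselCoeff (μ + 1) k * (-(s : ℂ)) ^ k) := by
    rw [← succ_mul_besselCoeff_succ]
    rw [Nat.add_sub_cancel]
    push_cast
    ring
  let u : ℕ → ℝ := fun k => ‖besselCoeff μ k‖ * (k * R ^ (k - 1))
  have hu : Summable u := by
    rw [← summable_nat_add_iff 1]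
    refine ((summable_besselCoeff_mul_pow hμ' (R : ℂ)).norm).congr fun k => ?_
    have h1 : ‖(k : ℂ) + 1‖ = (k : ℝ) + 1 := by
      rw [← Nat.cast_succ, Complex.norm_natCast]; push_cast; rfl
    rw [← succ_mul_besselCoeff_succ]
    simp only [u, norm_mul, norm_pow, h1, Complex.norm_real, Real.norm_eq_abs, abs_of_pos hR0,
      Nat.add_sub_cancel]
    push_cast
    ring
  have hmain := hasDerivAt_tsum_of_isPreconnected (y₀ := (0 : ℝ)) (y := t) hu
    (Metric.isOpen_ball (x := (0 : ℝ)) (ε := R)) (convex_ball (0 : ℝ) R).isPreconnected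
    (fun k s _ => hderiv k s) (fun k s hs => ?_) (by simpa using hR0)
    (summable_besselCoeff_mul_pow hμ _) (by simp [hR])
  · refine hmain.congr_deriv ?_
    have hsum : Summable fun k : ℕ => besselCoeff μ k * (k * (-(t : ℂ)) ^ (k - 1) * (-1)) := by
      rw [← summable_nat_add_iff 1]
      exact ((summable_besselCoeff_mul_pow hμ' (-(t : ℂ))).neg).congr fun k => (hshift t k).symm
    rw [hsum.tsum_eq_zero_add, tsum_congr (hshift t), tsum_neg]
    simp [besselEntire]
  · have hs' : |s| ≤ R := by simpa using (Metric.mem_ball.mp hs).le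
    simp only [u, norm_mul, norm_pow, norm_neg, Complex.norm_real, Real.norm_eq_abs, norm_one,
      mul_one, Complex.norm_natCast]
    gcongr

lemma continuous_besselEntire {μ : ℂ} (hμ : -1 < μ.re) : Continuous (besselEntire μ) :=
  continuous_iff_continuousAt.mpr fun t => (hasDerivAt_besselEntire hμ t).continuousAt

lemma mul_besselEntire_add_two {μ : ℂ} (hμ : -1 < μ.re) (t : ℝ) :
    (t : ℂ) * besselEntire (μ + 2) t
      = (μ + 1) * besselEntire (μ + 1) t - besselEntire μ t := by
  have hμ' : -1 < (μ + 1).re := by simp; linarith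
  have h0 := summable_besselCoeff_mul_pow hμ (-(t : ℂ))
  have h1 := (summable_besselCoeff_mul_pow hμ' (-(t : ℂ))).mul_left (μ + 1)
  have hterm (k : ℕ) : (μ + 1) * (besselCoeff (μ + 1) k * (-(t : ℂ)) ^ k)
      - besselCoeff μ k * (-(t : ℂ)) ^ k = -(k * besselCoeff (μ + 1) k * (-(t : ℂ)) ^ k) := by
    rw [besselCoeff_eq_mul hμ k]; ring
  have h2 := h1.sub h0
  simp only [besselEntire]
  rw [← tsum_mul_left, ← tsum_mul_left, ← h1.tsum_sub h0, h2.tsum_eq_zero_add]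
  simp_rw [hterm]
  simp only [Nat.cast_zero, zero_mul, neg_zero, zero_add]
  refine tsum_congr fun k => ?_
  rw [show μ + 2 = μ + 1 + 1 by ring, ← succ_mul_besselCoeff_succ]
  push_cast
  ring

/-- The energy `|E_μ(t)|² + t |E_{μ+1}(t)|²` grows at most linearly. -/
lemma antitoneOn_besselEntire_energy {μ : ℂ} (hμ : -1 < μ.re) :
    AntitoneOn (fun t : ℝ => (‖besselEntire μ t‖ ^ 2 + t * ‖besselEntire (μ + 1) t‖ ^ 2) / t)
      (Ici 1) := by
  have hμ' : -1 < (μ + 1).re := by simp; linarith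
  have hd (t : ℝ) (ht : 0 < t) := ((hasDerivAt_besselEntire hμ t).norm_sq.add
    ((hasDerivAt_id t).mul (hasDerivAt_besselEntire hμ' t).norm_sq)).div (hasDerivAt_id t) ht.ne'
  refine antitoneOn_of_deriv_nonpos (convex_Ici 1)
    (fun t ht => (hd t (zero_lt_one.trans_le ht)).continuousAt.continuousWithinAt) ?_ ?_
  · intro t ht
    rw [interior_Ici] at ht
    exact (hd t (zero_lt_one.trans ht)).differentiableAt.differentiableWithinAt
  · intro t ht
    rw [interior_Ici] at ht
    have ht0 : 0 < t := zero_lt_one.trans ht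
    refine (hd t ht0).deriv.trans_le (div_nonpos_of_nonpos_of_nonneg ?_ (sq_nonneg _))
    have hrec := mul_besselEntire_add_two hμ t
    have hre := congrArg Complex.re hrec
    have him := congrArg Complex.im hrec
    rw [show μ + 1 + 1 = μ + 2 by ring]
    simp only [Complex.mul_re, Complex.mul_im, Complex.ofReal_re, Complex.ofReal_im, zero_mul,
      sub_zero, add_zero, Complex.sub_re, Complex.sub_im, Complex.add_re, Complex.add_im,
      Complex.one_re, Complex.one_im] at hre him
    simp only [Pi.add_apply, Pi.mul_apply, id, ← Complex.normSq_eq_norm_sq, Complex.normSq_apply,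
      Complex.inner, Complex.mul_re, Complex.conj_re, Complex.conj_im, Complex.neg_re,
      Complex.neg_im]
    generalize (besselEntire (μ + 2) t).re = c at *
    generalize (besselEntire (μ + 2) t).im = d at *
    generalize (besselEntire (μ + 1) t).re = p at *
    generalize (besselEntire (μ + 1) t).im = q at *
    generalize (besselEntire μ t).re = a at *
    generalize (besselEntire μ t).im = b at *
    have hnn : 0 ≤ 2 * (μ.re + 1) * (p * p + q * q) * t + (a * a + b * b) := by
      have : 0 ≤ μ.re + 1 := by linarith
      have := mul_self_nonneg p
      have := mul_self_nonneg q
      have := mul_self_nonneg a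
      have := mul_self_nonneg b
      positivity
    linear_combination hnn - 2 * p * t * hre - 2 * q * t * him

/-- Elementary growth bound for the entire part of the Bessel function. -/
lemma exists_norm_besselEntire_le {μ : ℂ} (hμ : -1 < μ.re) :
    ∃ C : ℝ, ∀ t : ℝ, 0 ≤ t → ‖besselEntire μ t‖ ≤ C * (1 + t) := by
  obtain ⟨A, hA⟩ := (isCompact_Icc (a := (0 : ℝ)) (b := 1)).exists_bound_of_continuousOn
    (continuous_besselEntire hμ).continuousOn
  set B := ‖besselEntire μ 1‖ ^ 2 + ‖besselEntire (μ + 1) 1‖ ^ 2 with hB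
  have hA0 : 0 ≤ A := (norm_nonneg _).trans (hA 0 (by simp))
  refine ⟨A + √B, fun t ht => ?_⟩
  have hsB := Real.sqrt_nonneg B
  rcases le_total t 1 with h1 | h1
  · refine (hA t ⟨ht, h1⟩).trans ?_
    nlinarith [mul_nonneg hA0 ht, mul_nonneg hsB ht]
  · have h := antitoneOn_besselEntire_energy hμ (mem_Ici.mpr le_rfl) (mem_Ici.mpr h1) h1
    simp only [one_mul, div_one] at h
    rw [div_le_iff₀ (by linarith), ← hB] at h
    have hle : ‖besselEntire μ t‖ ≤ √B * t := by
      refine abs_le_of_sq_le_sq' ?_ (by positivity) |>.2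
      rw [mul_pow, Real.sq_sqrt (by positivity)]
      have : 0 ≤ t * ‖besselEntire (μ + 1) t‖ ^ 2 := by positivity
      have hB0 : 0 ≤ B := by positivity
      nlinarith [mul_nonneg (mul_nonneg hB0 ht) (sub_nonneg.mpr h1)]
    nlinarith [mul_nonneg hA0 ht]

/-- Raising the order by `2k` gains a factor `t⁻ᵏ` of decay. -/
lemma exists_pow_mul_norm_besselEntire_le (k : ℕ) : ∀ {μ : ℂ}, -1 < μ.re →
    ∃ C : ℝ, ∀ t : ℝ, 0 ≤ t → t ^ k * ‖besselEntire (μ + 2 * k) t‖ ≤ C * (1 + t) := by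
  induction k with
  | zero => intro μ hμ; simpa using exists_norm_besselEntire_le hμ
  | succ k ih =>
    intro μ hμ
    have hμ' : -1 < (μ + 1).re := by simp; linarith
    have hk : -1 < (μ + 2 * k).re := by
      have : (0 : ℝ) ≤ k := k.cast_nonneg
      simp; linarith
    obtain ⟨C₀, h₀⟩ := ih hμ
    obtain ⟨C₁, h₁⟩ := ih hμ'
    refine ⟨‖μ + 2 * k + 1‖ * C₁ + C₀, fun t ht => ?_⟩
    have hrec := congrArg norm (mul_besselEntire_add_two hk t)
    rw [norm_mul, Complex.norm_real, Real.norm_of_nonneg ht] at hrec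
    rw [show μ + 2 * ((k + 1 : ℕ) : ℂ) = μ + 2 * k + 2 by push_cast; ring, pow_succ, mul_assoc,
      hrec]
    have h₁' := h₁ t ht
    rw [show μ + 1 + 2 * (k : ℂ) = μ + 2 * k + 1 by ring] at h₁'
    calc t ^ k * ‖(μ + 2 * k + 1) * besselEntire (μ + 2 * k + 1) t - besselEntire (μ + 2 * k) t‖
        ≤ t ^ k * (‖μ + 2 * k + 1‖ * ‖besselEntire (μ + 2 * k + 1) t‖
            + ‖besselEntire (μ + 2 * k) t‖) := by
          gcongr
          exact (norm_sub_le _ _).trans_eq (by rw [norm_mul])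
      _ = ‖μ + 2 * k + 1‖ * (t ^ k * ‖besselEntire (μ + 2 * k + 1) t‖)
            + t ^ k * ‖besselEntire (μ + 2 * k) t‖ := by ring
      _ ≤ ‖μ + 2 * k + 1‖ * (C₁ * (1 + t)) + C₀ * (1 + t) := by
          exact add_le_add (mul_le_mul_of_nonneg_left h₁' (norm_nonneg _)) (h₀ t ht)
      _ = _ := by ring

/-- `h` decays at `+∞` faster than every power. -/
def HasRapidDecay (h : ℝ → ℂ) : Prop :=
  ∀ m : ℕ, ∃ C : ℝ, ∀ x : ℝ, 1 ≤ x → x ^ m * ‖h x‖ ≤ C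

lemma HasRapidDecay.mul_of_linear_growth {h u : ℝ → ℂ} (hh : HasRapidDecay h) {C : ℝ}
    (hu : ∀ x : ℝ, 0 ≤ x → ‖u x‖ ≤ C * (1 + x)) : HasRapidDecay fun x => h x * u x := by
  intro m
  obtain ⟨A, hA⟩ := hh m
  obtain ⟨B, hB⟩ := hh (m + 1)
  have hC : 0 ≤ C := by simpa using (norm_nonneg _).trans (hu 0 le_rfl)
  refine ⟨C * (A + B), fun x hx => ?_⟩
  have hx0 : 0 ≤ x := zero_le_one.trans hx
  calc x ^ m * ‖h x * u x‖ ≤ x ^ m * (‖h x‖ * (C * (1 + x))) := by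
        rw [norm_mul]; gcongr; exact hu x hx0
    _ = C * (x ^ m * ‖h x‖ + x ^ (m + 1) * ‖h x‖) := by ring
    _ ≤ C * (A + B) := by gcongr; exacts [hA x hx, hB x hx]

lemma HasRapidDecay.isBigO_rpow_neg {h : ℝ → ℂ} (hh : HasRapidDecay h) (m : ℕ) :
    h =O[atTop] fun x : ℝ => x ^ (-(m : ℝ)) := by
  obtain ⟨C, hC⟩ := hh m
  refine Asymptotics.IsBigO.of_bound C ?_
  filter_upwards [eventually_ge_atTop 1] with x hx
  have hx0 : 0 < x := zero_lt_one.trans_le hx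
  rw [Real.rpow_neg hx0.le, Real.rpow_natCast, norm_inv, norm_pow, Real.norm_of_nonneg hx0.le,
    ← div_eq_mul_inv, le_div_iff₀ (by positivity), mul_comm]
  exact hC x hx

lemma HasRapidDecay.integrableOn_cpow_mul {h : ℝ → ℂ} (hh : HasRapidDecay h) (hc : Continuous h)
    {μ : ℂ} (hμ : -1 < μ.re) : IntegrableOn (fun x : ℝ => (x : ℂ) ^ μ * h x) (Ioi 0) := by
  obtain ⟨m, hm⟩ := exists_nat_gt (μ + 1).re
  have h0 : h =O[𝓝[>] 0] fun x : ℝ => x ^ (-(0 : ℝ)) := by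
    simpa using (hc.continuousAt.tendsto.mono_left nhdsWithin_le_nhds).isBigO_one ℝ
  have := mellinConvergent_of_isBigO_rpow (s := μ + 1)
    (hc.locallyIntegrable.locallyIntegrableOn _) (hh.isBigO_rpow_neg m) hm h0
    (by simp; linarith)
  simpa [MellinConvergent] using this

lemma HasRapidDecay.tendsto_cpow_mul {h : ℝ → ℂ} (hh : HasRapidDecay h) (μ : ℂ) :
    Tendsto (fun x : ℝ => (x : ℂ) ^ μ * h x) atTop (𝓝 0) := by
  obtain ⟨m, hm⟩ := exists_nat_gt μ.re
  have h1 : (fun x : ℝ => (x : ℂ) ^ μ) =O[atTop] fun x : ℝ => x ^ μ.re := by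
    refine Asymptotics.IsBigO.of_bound 1 ?_
    filter_upwards [eventually_gt_atTop 0] with x hx
    rw [Complex.norm_cpow_eq_rpow_re_of_pos hx, one_mul]
    exact Real.le_norm_self _
  refine (h1.mul (hh.isBigO_rpow_neg m)).trans_tendsto ?_
  refine (tendsto_rpow_neg_atTop (sub_pos.mpr hm)).congr' ?_
  filter_upwards [eventually_gt_atTop 0] with x hx
  rw [← Real.rpow_add hx]
  congr 1
  ring

lemma exists_norm_besselEntire_mul_le {μ : ℂ} (hμ : -1 < μ.re) {y : ℝ} (hy : 1 ≤ y) :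
    ∃ C : ℝ, ∀ x : ℝ, 0 ≤ x → ‖besselEntire μ (x * y)‖ ≤ C * (1 + x) := by
  obtain ⟨C, hC⟩ := exists_norm_besselEntire_le hμ
  have hC0 : 0 ≤ C := by simpa using (norm_nonneg _).trans (hC 0 le_rfl)
  refine ⟨C * y, fun x hx => (hC _ (by positivity)).trans ?_⟩
  rw [mul_assoc]
  gcongr
  linarith

lemma hasDerivAt_cpow_mul_besselEntire {μ : ℂ} (hμ : -1 < μ.re) (y : ℝ) {x : ℝ} (hx : 0 < x) :
    HasDerivAt (fun x : ℝ => (x : ℂ) ^ (μ + 1) * besselEntire (μ + 1) (x * y))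
      ((x : ℂ) ^ μ * besselEntire μ (x * y)) x := by
  have hμ' : -1 < (μ + 1).re := by simp; linarith
  have hne : μ + 1 ≠ 0 := by simpa using natCast_add_add_one_ne_zero hμ 0
  have hE := (hasDerivAt_besselEntire hμ' (x * y)).scomp x ((hasDerivAt_id x).mul_const y)
  refine ((hasDerivAt_ofReal_cpow_const hx.ne' hne).mul hE).congr_deriv ?_
  have hrec := mul_besselEntire_add_two hμ (x * y)
  rw [show μ + 1 + 1 = μ + 2 by ring, Complex.cpow_add _ _ (by exact_mod_cast hx.ne'),
    Complex.cpow_one, add_sub_cancel_right, one_mul, Complex.real_smul]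
  push_cast at hrec
  simp only [Function.comp, id]
  linear_combination -(x : ℂ) ^ μ * hrec

/-- Integration by parts raises the order of the Bessel kernel by one. -/
lemma integral_cpow_mul_besselEntire {μ : ℂ} (hμ : -1 < μ.re) {y : ℝ} (hy : 1 ≤ y) {h h' : ℝ → ℂ}
    (hd : ∀ x, HasDerivAt h (h' x) x) (hc' : Continuous h') (hh : HasRapidDecay h)
    (hh' : HasRapidDecay h') :
    ∫ x in Ioi (0 : ℝ), (x : ℂ) ^ μ * (h x * besselEntire μ (x * y))
      = -∫ x in Ioi (0 : ℝ), (x : ℂ) ^ (μ + 1) * (h' x * besselEntire (μ + 1) (x * y)) := by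
  have hμ' : -1 < (μ + 1).re := by simp; linarith
  have hc : Continuous h := continuous_iff_continuousAt.mpr fun x => (hd x).continuousAt
  have hE : Continuous fun x : ℝ => besselEntire μ (x * y) :=
    (continuous_besselEntire hμ).comp (continuous_mul_const y)
  have hE' : Continuous fun x : ℝ => besselEntire (μ + 1) (x * y) :=
    (continuous_besselEntire hμ').comp (continuous_mul_const y)
  obtain ⟨C, hC⟩ := exists_norm_besselEntire_mul_le hμ hy
  obtain ⟨C', hC'⟩ := exists_norm_besselEntire_mul_le hμ' hy
  have hi := (hh.mul_of_linear_growth hC).integrableOn_cpow_mul (hc.mul hE) hμ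
  have hi' := (hh'.mul_of_linear_growth hC').integrableOn_cpow_mul (hc'.mul hE') hμ'
  have hne : μ + 1 ≠ 0 := by simpa using natCast_add_add_one_ne_zero hμ 0
  have hcont : ContinuousAt
      (fun x : ℝ => (x : ℂ) ^ (μ + 1) * (h x * besselEntire (μ + 1) (x * y))) 0 :=
    (Complex.continuousAt_ofReal_cpow_const 0 (μ + 1) (Or.inl (by simp; linarith))).mul
      (hc.mul hE').continuousAt
  have hmain := integral_Ioi_of_hasDerivAt_of_tendsto hcont.continuousWithinAt
    (fun x hx => (((hasDerivAt_cpow_mul_besselEntire hμ y hx).mul (hd x)).congr_deriv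
      (g' := (x : ℂ) ^ μ * (h x * besselEntire μ (x * y))
        + (x : ℂ) ^ (μ + 1) * (h' x * besselEntire (μ + 1) (x * y))) (by ring)).congr_of_eventuallyEq
      (Eventually.of_forall fun x => by simp only [Pi.mul_apply]; ring)) (hi.add hi')
    ((hh.mul_of_linear_growth hC').tendsto_cpow_mul (μ + 1))
  rw [integral_add hi hi'] at hmain
  simp only [Complex.ofReal_zero, Complex.zero_cpow hne, zero_mul, sub_zero] at hmain
  exact eq_neg_of_add_eq_zero_left hmain

lemma integral_cpow_mul_besselEntire_iterate {g : ℝ → ℂ} (hg : ContDiff ℝ (⊤ : ℕ∞) g)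
    (hr : RapidlyDecreasing g) {μ : ℂ} (hμ : -1 < μ.re) {y : ℝ} (hy : 1 ≤ y) (n : ℕ) :
    ∫ x in Ioi (0 : ℝ), (x : ℂ) ^ μ * (g x * besselEntire μ (x * y))
      = (-1) ^ n * ∫ x in Ioi (0 : ℝ),
          (x : ℂ) ^ (μ + n) * (iteratedDeriv n g x * besselEntire (μ + n) (x * y)) := by
  induction n with
  | zero => simp
  | succ n ih =>
    have hn : -1 < (μ + n).re := by
      have : (0 : ℝ) ≤ n := n.cast_nonneg
      simp; linarith
    have hd (x : ℝ) : HasDerivAt (iteratedDeriv n g) (iteratedDeriv (n + 1) g x) x := by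
      rw [iteratedDeriv_succ]
      exact (hg.differentiable_iteratedDeriv n (by exact_mod_cast ENat.natCast_lt_top n) x).hasDerivAt
    rw [ih, integral_cpow_mul_besselEntire hn hy hd
      ((contDiff_infty.mp hg _).continuous_iteratedDeriv (n + 1) le_rfl) (fun m => hr m n)
      (fun m => hr m (n + 1))]
    push_cast
    simp only [add_assoc]
    ring

lemma besselJ_two_mul_sqrt (ν : ℂ) {t : ℝ} (ht : 0 < t) :
    besselJ ν (2 * √t) = (t : ℂ) ^ (ν / 2) * besselEntire ν t := by
  have hs : ((√t : ℝ) : ℂ) ≠ 0 := by exact_mod_cast (Real.sqrt_pos.mpr ht).ne'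
  have hsq : ((√t : ℝ) : ℂ) ^ 2 = t := by exact_mod_cast Real.sq_sqrt ht.le
  have hpow : ((√t : ℝ) : ℂ) ^ ν = (t : ℂ) ^ (ν / 2) := by
    rw [Real.sqrt_eq_rpow, ← Complex.cpow_mul_ofReal_nonneg ht.le]
    congr 1
    push_cast
    ring
  rw [besselJ, besselEntire, ← tsum_mul_left]
  refine tsum_congr fun k => ?_
  rw [mul_div_cancel_left₀ _ (two_ne_zero' ℝ), Complex.cpow_add _ _ hs, hpow,
    show (2 * (k : ℂ)) = ((2 * k : ℕ) : ℂ) by push_cast; rfl, Complex.cpow_natCast, pow_mul, hsq,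
    Complex.Gamma_nat_eq_factorial, besselCoeff, neg_pow (t : ℂ)]
  ring

lemma hankel_eq_integral_besselEntire {ν : ℂ} {f g : ℝ → ℂ}
    (hf : ∀ x : ℝ, 0 ≤ x → f x = (x : ℂ) ^ ((ν + 1) / 2) * g x) {y : ℝ} (hy : 0 < y) :
    hankel ν f y = (y : ℂ) ^ ((ν + 1) / 2) *
      ∫ x in Ioi (0 : ℝ), (x : ℂ) ^ ν * (g x * besselEntire ν (x * y)) := by
  rw [hankel, ← integral_const_mul]
  refine setIntegral_congr_fun measurableSet_Ioi fun x hx => ?_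
  have hx0 : 0 < x := hx
  have hxC : (x : ℂ) ≠ 0 := by exact_mod_cast hx0.ne'
  have hyC : (y : ℂ) ≠ 0 := by exact_mod_cast hy.ne'
  have hxy : 0 < x * y := mul_pos hx0 hy
  have hxyC : ((x * y : ℝ) : ℂ) ≠ 0 := by exact_mod_cast hxy.ne'
  have hsqrt : ((√(x * y) : ℝ) : ℂ) = ((x * y : ℝ) : ℂ) ^ (1 / 2 : ℂ) := by
    rw [Real.sqrt_eq_rpow, Complex.ofReal_cpow hxy.le]; simp
  have hk : ((x * y : ℝ) : ℂ) ^ (1 / 2 : ℂ) * ((x * y : ℝ) : ℂ) ^ (ν / 2)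
      = (x : ℂ) ^ ((ν + 1) / 2) * (y : ℂ) ^ ((ν + 1) / 2) := by
    rw [← Complex.cpow_add _ _ hxyC, Complex.ofReal_mul,
      Complex.mul_cpow_ofReal_nonneg hx0.le hy.le]
    ring_nf
  have hx2 : (x : ℂ) ^ ((ν + 1) / 2) * (x : ℂ) ^ ((ν + 1) / 2) = (x : ℂ) ^ ν * x := by
    rw [← Complex.cpow_add _ _ hxC, add_halves, Complex.cpow_add _ _ hxC, Complex.cpow_one]
  rw [hf x hx0.le, besselJ_two_mul_sqrt ν hxy, hsqrt, div_eq_iff hxC]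
  linear_combination (x : ℂ) ^ ((ν + 1) / 2) * g x * besselEntire ν (x * y) * hk
    + (y : ℂ) ^ ((ν + 1) / 2) * g x * besselEntire ν (x * y) * hx2

/-- for `f ∈ S_ν([0,∞))` with `Re ν > -1`, the Hankel transform
`H_ν(f)` is rapidly decreasing at infinity. -/
theorem hankel_rapidly_decreasing (ν : ℂ) (hν : -1 < ν.re) (f : ℝ → ℂ) (hf : MemSnu ν f) :
    ∀ m : ℕ, ∃ C : ℝ, ∀ y : ℝ, 1 ≤ y → ‖hankel ν f y‖ ≤ C * (y ^ m)⁻¹ := by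
  intro m
  obtain ⟨f₁, ⟨g, hg, hfg, hr⟩, hf₁⟩ := hf
  have hfg' (x : ℝ) (hx : 0 ≤ x) : f x = (x : ℂ) ^ ((ν + 1) / 2) * g x := by
    rw [hf₁ x hx, hfg x hx]
  obtain ⟨N, hN⟩ := exists_nat_ge ((ν + 1) / 2).re
  set k := m + 1 + N with hk
  obtain ⟨C, hC⟩ := exists_pow_mul_norm_besselEntire_le k hν
  have hC0 : 0 ≤ C := by
    have h0 : 0 ≤ (0 : ℝ) ^ k * ‖besselEntire (ν + 2 * k) 0‖ := by positivity
    simpa using h0.trans (hC 0 le_rfl)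
  set φ : ℝ → ℂ := fun x => (x : ℂ) ^ (ν + k) * (iteratedDeriv (2 * k) g x * (1 + x : ℂ)) with hφ
  have hφi : IntegrableOn φ (Ioi 0) := by
    have hdecay : HasRapidDecay fun x => iteratedDeriv (2 * k) g x * (1 + x : ℂ) := by
      refine HasRapidDecay.mul_of_linear_growth (C := 1) (fun m => hr m (2 * k)) fun x hx => ?_
      rw [one_mul]
      exact (norm_add_le _ _).trans_eq (by simp [abs_of_nonneg hx])
    refine hdecay.integrableOn_cpow_mul ?_ ?_
    · exact ((contDiff_infty.mp hg _).continuous_iteratedDeriv (2 * k) le_rfl).mul (by fun_prop)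
    · have : (0 : ℝ) ≤ k := k.cast_nonneg
      simp only [Complex.add_re, Complex.natCast_re]
      linarith
  refine ⟨C * ∫ x in Ioi (0 : ℝ), ‖φ x‖, fun y hy => ?_⟩
  have hy0 : 0 < y := zero_lt_one.trans_le hy
  have hpt (x : ℝ) (hx : 0 < x) : ‖(x : ℂ) ^ (ν + (2 * k : ℕ)) *
      (iteratedDeriv (2 * k) g x * besselEntire (ν + (2 * k : ℕ)) (x * y))‖
        ≤ C * y / y ^ k * ‖φ x‖ := by
    have hE := hC (x * y) (by positivity)
    have h1 : ‖(1 + x : ℂ)‖ = 1 + x := by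
      rw [← Complex.ofReal_one, ← Complex.ofReal_add, Complex.norm_real,
        Real.norm_of_nonneg (by positivity)]
    have h2 : ‖(x : ℂ) ^ (ν + (2 * k : ℕ))‖ = ‖(x : ℂ) ^ (ν + k)‖ * x ^ k := by
      have hxC : (x : ℂ) ≠ 0 := by exact_mod_cast hx.ne'
      rw [show ν + (2 * k : ℕ) = ν + k + k by push_cast; ring, Complex.cpow_add _ _ hxC, norm_mul,
        Complex.cpow_natCast, norm_pow, Complex.norm_real, Real.norm_of_nonneg hx.le]
    have h3 : x ^ k * ‖besselEntire (ν + 2 * k) (x * y)‖ ≤ C * y / y ^ k * (1 + x) := by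
      rw [div_mul_eq_mul_div, le_div_iff₀ (by positivity)]
      calc _ = (x * y) ^ k * ‖besselEntire (ν + 2 * k) (x * y)‖ := by ring
        _ ≤ C * (1 + x * y) := hE
        _ ≤ C * (y * (1 + x)) := by gcongr; linarith
        _ = _ := by ring
    push_cast at h2 ⊢
    simp only [hφ, norm_mul, h1]
    rw [h2]
    calc _ = ‖(x : ℂ) ^ (ν + k)‖ * ‖iteratedDeriv (2 * k) g x‖
          * (x ^ k * ‖besselEntire (ν + 2 * k) (x * y)‖) := by ring
      _ ≤ ‖(x : ℂ) ^ (ν + k)‖ * ‖iteratedDeriv (2 * k) g x‖ * (C * y / y ^ k * (1 + x)) := by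
          gcongr
      _ = _ := by ring
  have hint := norm_integral_le_of_norm_le (hφi.norm.const_mul (C * y / y ^ k))
    ((ae_restrict_iff' measurableSet_Ioi).mpr (Eventually.of_forall hpt))
  rw [integral_const_mul] at hint
  rw [hankel_eq_integral_besselEntire hfg' hy0,
    integral_cpow_mul_besselEntire_iterate hg hr hν hy (2 * k), norm_mul, norm_mul, norm_pow,
    norm_neg, norm_one, one_pow, one_mul, Complex.norm_cpow_eq_rpow_re_of_pos hy0]
  have hyN : y ^ ((ν + 1) / 2).re ≤ y ^ N := by
    rw [← Real.rpow_natCast]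
    exact Real.rpow_le_rpow_of_exponent_le hy hN
  refine (mul_le_mul hyN hint (norm_nonneg _) (by positivity)).trans_eq ?_
  rw [hk]
  field_simp
  ring
end

section
/- Let ν ∈ ℂ with Re(ν) > −1. Then the Hankel transform H_ν maps S_ν([0,∞)) into itself: for every f ∈ S_ν([0,∞)), the function H_ν(f) (extended by H_ν(f)(0) = 0) belongs to S_ν([0,∞)). -/
open MeasureTheory Set

/-- The Bessel–Clifford function `∑ₖ (-t)ᵏ / (k! Γ(k + ν + 1))`, for which
`J_ν(2 √t) = t ^ (ν / 2) * besselClifford ν t`. -/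
noncomputable def besselClifford (ν : ℂ) (t : ℝ) : ℂ :=
  ∑' k : ℕ, ((-t : ℝ) : ℂ) ^ k / (k.factorial * Complex.Gamma (k + ν + 1))

lemma add_one_ne_zero_of_re {ν : ℂ} (hν : -1 < ν.re) : ν + 1 ≠ 0 := by
  intro h
  have := congrArg Complex.re h
  simp at this
  linarith

lemma norm_Gamma_inv_le {ν : ℂ} (hν : -1 < ν.re) :
    ∃ C : ℝ, 0 ≤ C ∧ ∀ k : ℕ, ‖(Complex.Gamma (k + ν + 1))⁻¹‖ ≤ C := by
  refine ⟨max ‖(Complex.Gamma (ν + 1))⁻¹‖ ‖(Complex.Gamma (ν + 1 + 1))⁻¹‖,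
    le_max_of_le_left (norm_nonneg _), fun k => ?_⟩
  induction k with
  | zero => simp
  | succ k ih =>
    rcases Nat.eq_zero_or_pos k with rfl | hk
    · refine le_max_of_le_right (le_of_eq ?_)
      congr 3
      push_cast
      ring
    · have hk1 : (1 : ℝ) ≤ k := by exact_mod_cast hk
      have hre : (1 : ℝ) ≤ ((k : ℂ) + ν + 1).re := by simp; linarith
      have hne : (k : ℂ) + ν + 1 ≠ 0 := by
        intro h
        rw [h] at hre
        norm_num at hre
      have h1 : (1 : ℝ) ≤ ‖(k : ℂ) + ν + 1‖ := hre.trans (Complex.re_le_norm _)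
      rw [show ((k + 1 : ℕ) : ℂ) + ν + 1 = (k + ν + 1) + 1 by push_cast; ring,
        Complex.Gamma_add_one _ hne, mul_inv, norm_mul, norm_inv]
      exact (mul_le_of_le_one_left (norm_nonneg _) (inv_le_one_of_one_le₀ h1)).trans ih

lemma summable_besselClifford {ν : ℂ} (hν : -1 < ν.re) (t : ℝ) :
    Summable fun k : ℕ =>
      ((-t : ℝ) : ℂ) ^ k / (k.factorial * Complex.Gamma (k + ν + 1)) := by
  obtain ⟨C, -, hC⟩ := norm_Gamma_inv_le hν
  refine Summable.of_norm_bounded ((Real.summable_pow_div_factorial |t|).mul_right C) fun k => ?_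
  rw [div_mul_eq_div_div, div_eq_mul_inv _ (Complex.Gamma _), norm_mul]
  gcongr
  · simp
  · exact hC k

lemma hasDerivAt_besselClifford {ν : ℂ} (hν : -1 < ν.re) (t : ℝ) :
    HasDerivAt (besselClifford ν) (-besselClifford (ν + 1) t) t := by
  obtain ⟨C, hC0, hC⟩ := norm_Gamma_inv_le hν
  set R : ℝ := |t| + 1
  have hR0 : 0 ≤ R := by positivity
  have hsum : Summable fun k : ℕ => (k : ℝ) * R ^ (k - 1) / k.factorial * C := by
    refine Summable.mul_right C ((summable_nat_add_iff 1).1 ?_)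
    refine (Real.summable_pow_div_factorial R).congr fun k => ?_
    rw [Nat.factorial_succ]
    push_cast
    field_simp
  have key := hasDerivAt_tsum_of_isPreconnected (𝕜 := ℝ) (y := t)
    (g := fun (k : ℕ) (t : ℝ) =>
      ((-t : ℝ) : ℂ) ^ k / (k.factorial * Complex.Gamma (k + ν + 1)))
    (g' := fun (k : ℕ) (t : ℝ) => (k * ((-t : ℝ) : ℂ) ^ (k - 1) * (-1)) /
      (k.factorial * Complex.Gamma (k + ν + 1))) hsum
    (Metric.isOpen_ball (x := (0 : ℝ)) (ε := R)) (convex_ball _ _).isPreconnected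
    (fun k y _ => ?_) (fun k y hy => ?_) (y₀ := 0) (Metric.mem_ball_self (by positivity))
    (summable_besselClifford hν 0) (by simp [R])
  · refine key.congr_deriv ?_
    have hterm : ∀ k : ℕ, (((k + 1 : ℕ) : ℂ) * ((-t : ℝ) : ℂ) ^ (k + 1 - 1) * (-1)) /
        ((k + 1).factorial * Complex.Gamma ((k + 1 : ℕ) + ν + 1)) =
        -(((-t : ℝ) : ℂ) ^ k / (k.factorial * Complex.Gamma (k + (ν + 1) + 1))) := fun k => by
      have : (k : ℂ) + 1 ≠ 0 := Nat.cast_add_one_ne_zero k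
      rw [Nat.factorial_succ,
        show ((k + 1 : ℕ) : ℂ) + ν + 1 = k + (ν + 1) + 1 by push_cast; ring]
      push_cast
      field_simp
    have hs := (summable_besselClifford (ν := ν + 1) (by simp; linarith) t).neg
    rw [((summable_nat_add_iff 1).1 (hs.congr fun k => (hterm k).symm)).tsum_eq_zero_add,
      tsum_congr hterm, tsum_neg]
    simp [besselClifford]
  · have h := (((hasDerivAt_id y).neg.ofReal_comp).pow k).div_const
      (k.factorial * Complex.Gamma (k + ν + 1))
    simpa using h
  · rw [div_mul_eq_div_div, div_eq_mul_inv _ (Complex.Gamma _), norm_mul]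
    have hy' : |y| ≤ R := by simpa using (Metric.mem_ball.1 hy).le
    gcongr
    · simp only [norm_mul, norm_div, norm_pow, norm_neg, norm_one, mul_one, Complex.norm_natCast,
        Complex.norm_real, Real.norm_eq_abs]
      gcongr
    · exact hC k

/-- The three-term recurrence of the Bessel–Clifford functions. -/
lemma besselClifford_recurrence {ν : ℂ} (hν : -1 < ν.re) (t : ℝ) :
    (ν + 1) * besselClifford (ν + 1) t - t * besselClifford (ν + 1 + 1) t =
      besselClifford ν t := by
  have h1 : -1 < (ν + 1).re := by simp; linarith
  have h2 : -1 < (ν + 1 + 1).re := by simp; linarith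
  have hne : ∀ k : ℕ, (k : ℂ) + ν + 1 ≠ 0 := fun k h => by
    have := congrArg Complex.re h
    have hk : (0 : ℝ) ≤ k := k.cast_nonneg
    simp at this
    linarith
  have hG : ∀ k : ℕ, Complex.Gamma (k + ν + 1) ≠ 0 := fun k =>
    Complex.Gamma_ne_zero_of_re_pos (by simp; have : (0 : ℝ) ≤ k := k.cast_nonneg; linarith)
  have s0 := summable_besselClifford hν t
  have s1 := (summable_besselClifford h1 t).mul_left (ν + 1)
  have s2 := (summable_besselClifford h2 t).mul_left (t : ℂ)
  simp only [besselClifford]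
  rw [← tsum_mul_left, ← tsum_mul_left, s1.tsum_eq_zero_add, s0.tsum_eq_zero_add, add_sub_assoc,
    ← ((summable_nat_add_iff 1).2 s1).tsum_sub s2]
  congr 1
  · simp only [pow_zero, Nat.factorial_zero, Nat.cast_zero, Nat.cast_one, zero_add, one_mul]
    rw [Complex.Gamma_add_one _ (add_one_ne_zero_of_re hν)]
    have := hG 0
    have := hne 0
    simp only [Nat.cast_zero, zero_add] at *
    field_simp
  · refine tsum_congr fun k => ?_
    have hk : (k : ℂ) + 1 ≠ 0 := Nat.cast_add_one_ne_zero k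
    have hf : (k.factorial : ℂ) ≠ 0 := by exact_mod_cast k.factorial_ne_zero
    have e1 : (k : ℂ) + (ν + 1 + 1) + 1 = ((k + 1 : ℕ) + ν + 1) + 1 := by push_cast; ring
    have e2 : ((k + 1 : ℕ) : ℂ) + (ν + 1) + 1 = ((k + 1 : ℕ) + ν + 1) + 1 := by push_cast; ring
    rw [e1, e2, Complex.Gamma_add_one _ (hne (k + 1)), Nat.factorial_succ]
    have a := hG (k + 1)
    have b := hne (k + 1)
    push_cast at *
    field_simp
    ring

lemma iteratedDeriv_besselClifford {ν : ℂ} (hν : -1 < ν.re) (n : ℕ) :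
    iteratedDeriv n (besselClifford ν) = fun t => (-1) ^ n * besselClifford (ν + n) t := by
  induction n with
  | zero => simp
  | succ n ih =>
    have hn : -1 < (ν + n).re := by
      have : (0 : ℝ) ≤ n := n.cast_nonneg
      simp
      linarith
    funext t
    rw [iteratedDeriv_succ, ih, ((hasDerivAt_besselClifford hn t).const_mul _).deriv]
    push_cast
    rw [pow_succ, add_assoc]
    ring

lemma differentiable_besselClifford {ν : ℂ} (hν : -1 < ν.re) :
    Differentiable ℝ (besselClifford ν) :=
  fun t => (hasDerivAt_besselClifford hν t).differentiableAt

lemma contDiff_besselClifford {ν : ℂ} (hν : -1 < ν.re) :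
    ContDiff ℝ (⊤ : ℕ∞) (besselClifford ν) := by
  refine contDiff_of_differentiable_iteratedDeriv fun n _ => ?_
  rw [iteratedDeriv_besselClifford hν]
  refine (differentiable_besselClifford ?_).const_mul _
  have : (0 : ℝ) ≤ n := n.cast_nonneg
  simp
  linarith

/-- Since `‖Φ_ν(t)‖² + t ‖Φ_ν'(t)‖²`, divided by `t`, is decreasing, the Bessel–Clifford function
`Φ_ν` grows at most linearly. -/
lemma norm_besselClifford_le {ν : ℂ} (hν : -1 < ν.re) :
    ∃ C : ℝ, 0 ≤ C ∧ ∀ t : ℝ, 0 ≤ t → ‖besselClifford ν t‖ ≤ C * (1 + t) := by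
  have h1 : -1 < (ν + 1).re := by simp; linarith
  set E : ℝ → ℝ := fun t => ‖besselClifford ν t‖ ^ 2 + t * ‖besselClifford (ν + 1) t‖ ^ 2
  have hE (t : ℝ) : HasDerivAt E (-(2 * ν.re + 1) * ‖besselClifford (ν + 1) t‖ ^ 2) t := by
    refine ((hasDerivAt_besselClifford hν t).norm_sq.add
      ((hasDerivAt_id t).mul (hasDerivAt_besselClifford h1 t).norm_sq)).congr_deriv ?_
    have hrec := besselClifford_recurrence hν t
    have hre := congrArg Complex.re hrec
    have him := congrArg Complex.im hrec
    simp only [Complex.sub_re, Complex.sub_im, Complex.mul_re, Complex.mul_im, Complex.add_re,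
      Complex.add_im, Complex.one_re, Complex.one_im, Complex.ofReal_re, Complex.ofReal_im] at hre him
    simp only [Complex.inner, Complex.sq_norm, Complex.normSq_apply, Complex.mul_re,
      Complex.conj_re, Complex.conj_im, Complex.neg_re, Complex.neg_im, id]
    rw [← hre, ← him]
    ring
  have hanti : AntitoneOn (fun t => E t / t) (Set.Ici 1) := by
    have hd (t : ℝ) (ht : 1 ≤ t) := (hE t).div (hasDerivAt_id t) (by simp; linarith)
    refine antitoneOn_of_deriv_nonpos (convex_Ici 1)
      (fun t ht => (hd t ht).continuousAt.continuousWithinAt)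
      (fun t ht => (hd t (interior_subset ht)).differentiableAt.differentiableWithinAt)
      fun t ht => ?_
    have ht1 : (1 : ℝ) ≤ t := interior_subset ht
    refine ((hd t ht1).deriv).trans_le (div_nonpos_of_nonpos_of_nonneg ?_ (sq_nonneg _))
    simp only [E, id]
    nlinarith [mul_nonneg (mul_nonneg (by linarith : 0 ≤ 2 * (ν.re + 1)) (by linarith : 0 ≤ t))
      (sq_nonneg ‖besselClifford (ν + 1) t‖), sq_nonneg ‖besselClifford ν t‖]
  obtain ⟨M, hM⟩ := isCompact_Icc.exists_bound_of_continuousOn (s := Set.Icc (0 : ℝ) 1)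
    (differentiable_besselClifford hν).continuous.continuousOn
  have hM0 : 0 ≤ M := (norm_nonneg _).trans (hM 0 (by simp))
  have hE1 : 0 ≤ E 1 := by positivity
  refine ⟨M + E 1 + 1, by positivity, fun t ht => ?_⟩
  rcases le_total t 1 with h | h
  · refine (hM t ⟨ht, h⟩).trans ?_
    nlinarith
  · have h2 : E t / t ≤ E 1 := by simpa using hanti (Set.mem_Ici.2 le_rfl) h h
    rw [div_le_iff₀ (by linarith)] at h2
    have h3 : ‖besselClifford ν t‖ ^ 2 ≤ E 1 * t :=
      le_trans (le_add_of_nonneg_right (by positivity)) h2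
    refine abs_le_of_sq_le_sq' (h3.trans ?_) (by positivity) |>.2
    have : E 1 * t ≤ (E 1 + 1) ^ 2 * (1 + t) ^ 2 := by
      apply mul_le_mul <;> nlinarith
    refine this.trans ?_
    rw [← mul_pow]
    gcongr
    linarith

/-- A representative of an element of `S([0,∞))`. -/
def IsHalfSchwartz (g : ℝ → ℂ) : Prop :=
  ContDiff ℝ (⊤ : ℕ∞) g ∧ RapidlyDecreasing g

namespace IsHalfSchwartz

variable {g h : ℝ → ℂ}

lemma deriv (hg : IsHalfSchwartz g) : IsHalfSchwartz (deriv g) :=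
  ⟨(contDiff_infty_iff_deriv.1 hg.1).2, fun m n => by
    simpa only [← iteratedDeriv_succ'] using hg.2 m (n + 1)⟩

lemma hasDerivAt (hg : IsHalfSchwartz g) (x : ℝ) : HasDerivAt g (_root_.deriv g x) x :=
  ((contDiff_infty_iff_deriv.1 hg.1).1 x).hasDerivAt

lemma continuous (hg : IsHalfSchwartz g) : Continuous g := hg.1.continuous

lemma add (hg : IsHalfSchwartz g) (hh : IsHalfSchwartz h) :
    IsHalfSchwartz (fun x => g x + h x) := by
  refine ⟨hg.1.add hh.1, fun m n => ?_⟩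
  obtain ⟨C, hC⟩ := hg.2 m n
  obtain ⟨D, hD⟩ := hh.2 m n
  refine ⟨C + D, fun x hx => ?_⟩
  rw [show (fun x => g x + h x) = g + h from rfl, iteratedDeriv_add
    (hg.1.contDiffAt.of_le (by exact_mod_cast le_top))
    (hh.1.contDiffAt.of_le (by exact_mod_cast le_top))]
  have := norm_add_le (iteratedDeriv n g x) (iteratedDeriv n h x)
  have hx0 : 0 ≤ x ^ m := by positivity
  nlinarith [hC x hx, hD x hx, mul_le_mul_of_nonneg_left this hx0]

lemma const_mul (hg : IsHalfSchwartz g) (c : ℂ) : IsHalfSchwartz (fun x => c * g x) := by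
  refine ⟨contDiff_const.mul hg.1, fun m n => ?_⟩
  obtain ⟨C, hC⟩ := hg.2 m n
  refine ⟨‖c‖ * C, fun x hx => ?_⟩
  rw [iteratedDeriv_const_mul c (hg.1.contDiffAt.of_le (by exact_mod_cast le_top)), norm_mul,
    mul_left_comm]
  gcongr
  exact hC x hx

lemma id_mul (hg : IsHalfSchwartz g) : IsHalfSchwartz (fun x => (x : ℂ) * g x) := by
  have hsmooth {g : ℝ → ℂ} (hg : IsHalfSchwartz g) :
      ContDiff ℝ (⊤ : ℕ∞) (fun x : ℝ => (x : ℂ) * g x) := Complex.ofRealCLM.contDiff.mul hg.1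
  refine ⟨hsmooth hg, fun m n => ?_⟩
  induction n generalizing g with
  | zero =>
    obtain ⟨C, hC⟩ := hg.2 (m + 1) 0
    refine ⟨C, fun x hx => ?_⟩
    have hx0 : 0 ≤ x := by linarith
    refine le_trans (le_of_eq ?_) (hC x hx)
    simp [abs_of_nonneg hx0]
    ring
  | succ n ih =>
    obtain ⟨C, hC⟩ := hg.2 m n
    obtain ⟨D, hD⟩ := ih hg.deriv
    refine ⟨C + D, fun x hx => ?_⟩
    have hderiv : _root_.deriv (fun x : ℝ => (x : ℂ) * g x) =
        g + fun x : ℝ => (x : ℂ) * _root_.deriv g x := by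
      funext y
      exact ((hasDerivAt_id y).ofReal_comp.mul (hg.hasDerivAt y)).deriv.trans (by simp)
    rw [iteratedDeriv_succ', hderiv, iteratedDeriv_add
      (hg.1.contDiffAt.of_le (by exact_mod_cast le_top))
      ((hsmooth hg.deriv).contDiffAt.of_le (by exact_mod_cast le_top))]
    have hx0 : 0 ≤ x ^ m := by positivity
    have := norm_add_le (iteratedDeriv n g x)
      (iteratedDeriv n (fun x : ℝ => (x : ℂ) * _root_.deriv g x) x)
    nlinarith [hC x hx, hD x hx, mul_le_mul_of_nonneg_left this hx0]

end IsHalfSchwartz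

/-- Weighted integrability against a kernel of linear growth. -/
lemma integrableOn_cpow_mul_mul {ν : ℂ} (hν : -1 < ν.re) {g K : ℝ → ℂ} (hg : IsHalfSchwartz g)
    (hK : Continuous K) {C : ℝ} (hKC : ∀ x, 0 ≤ x → ‖K x‖ ≤ C * (1 + x)) :
    IntegrableOn (fun x : ℝ => (x : ℂ) ^ ν * (g x * K x)) (Set.Ioi 0) := by
  have hcont : Continuous fun x => g x * K x := hg.continuous.mul hK
  obtain ⟨m, hm⟩ := exists_nat_ge (ν.re + 3)
  obtain ⟨D, hD⟩ := hg.2 m 0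
  have hC : 0 ≤ C := by simpa using (norm_nonneg _).trans (hKC 0 le_rfl)
  have := mellinConvergent_of_isBigO_rpow (a := ν.re + 2) (b := 0) (f := fun x => g x * K x)
    (s := ν + 1) (hcont.locallyIntegrable.locallyIntegrableOn _) ?_ (by simp) ?_
    (by simp; linarith)
  · simpa [MellinConvergent] using this
  · refine Asymptotics.IsBigO.of_bound (D * (C * 2)) ?_
    filter_upwards [Filter.eventually_ge_atTop 1] with x hx
    have hx0 : 0 < x := by linarith
    have h1 : x ^ m * ‖g x‖ ≤ D := by simpa using hD x hx
    have h2 : ‖K x‖ ≤ C * 2 * x := (hKC x hx0.le).trans (by nlinarith)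
    have h3 : x * x ^ (ν.re + 2) ≤ x ^ m := by
      rw [← Real.rpow_natCast x m, ← Real.rpow_one_add' hx0.le (by linarith)]
      exact Real.rpow_le_rpow_of_exponent_le hx (by linarith)
    rw [norm_mul, Real.norm_of_nonneg (by positivity), Real.rpow_neg hx0.le, ← div_eq_mul_inv,
      le_div_iff₀ (by positivity)]
    calc ‖g x‖ * ‖K x‖ * x ^ (ν.re + 2)
        ≤ ‖g x‖ * (C * 2 * x) * x ^ (ν.re + 2) := by gcongr
      _ = ‖g x‖ * (C * 2) * (x * x ^ (ν.re + 2)) := by ring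
      _ ≤ ‖g x‖ * (C * 2) * x ^ m := by gcongr
      _ = x ^ m * ‖g x‖ * (C * 2) := by ring
      _ ≤ D * (C * 2) := by gcongr
  · simpa using (hcont.tendsto 0).isBigO_one ℝ |>.mono nhdsWithin_le_nhds

lemma re_add_natCast_gt {ν : ℂ} (hν : -1 < ν.re) (n : ℕ) : -1 < (ν + n).re := by
  have : (0 : ℝ) ≤ n := n.cast_nonneg
  simp
  linarith

/-- The transform `y ↦ ∫₀^∞ x^ν g(x) K(xy) dx` with kernel `K`. -/
noncomputable def kernelTransform (ν : ℂ) (g K : ℝ → ℂ) (y : ℝ) : ℂ :=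
  ∫ x in Ioi (0 : ℝ), (x : ℂ) ^ ν * (g x * K (x * y))

/-- A smooth function all of whose derivatives grow at most linearly. -/
def HasLinearGrowth (K : ℝ → ℂ) : Prop :=
  ContDiff ℝ (⊤ : ℕ∞) K ∧ ∀ n : ℕ, ∃ C : ℝ, ∀ t : ℝ, ‖iteratedDeriv n K t‖ ≤ C * (1 + |t|)

namespace HasLinearGrowth

variable {K : ℝ → ℂ}

lemma deriv (hK : HasLinearGrowth K) : HasLinearGrowth (deriv K) :=
  ⟨(contDiff_infty_iff_deriv.1 hK.1).2, fun n => by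
    simpa only [← iteratedDeriv_succ'] using hK.2 (n + 1)⟩

lemma iteratedDeriv (hK : HasLinearGrowth K) (n : ℕ) : HasLinearGrowth (iteratedDeriv n K) := by
  induction n with
  | zero => simpa using hK
  | succ n ih => simpa only [iteratedDeriv_succ] using ih.deriv

lemma exists_norm_comp_mul_le (hK : HasLinearGrowth K) : ∃ C : ℝ, 0 ≤ C ∧
    ∀ x y : ℝ, 0 ≤ x → ‖K (x * y)‖ ≤ C * (1 + |y|) * (1 + x) := by
  obtain ⟨C, hC⟩ := hK.2 0
  have hC0 : 0 ≤ C := by simpa using (norm_nonneg _).trans (hC 0)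
  refine ⟨C, hC0, fun x y hx => (hC _).trans ?_⟩
  rw [abs_mul, abs_of_nonneg hx, mul_assoc]
  gcongr
  nlinarith [abs_nonneg y]

end HasLinearGrowth

lemma integrableOn_kernelTransform {ν : ℂ} (hν : -1 < ν.re) {g K : ℝ → ℂ} (hg : IsHalfSchwartz g)
    (hK : HasLinearGrowth K) (y : ℝ) :
    IntegrableOn (fun x : ℝ => (x : ℂ) ^ ν * (g x * K (x * y))) (Ioi 0) := by
  obtain ⟨C, -, hC⟩ := hK.exists_norm_comp_mul_le
  exact integrableOn_cpow_mul_mul hν hg (hK.1.continuous.comp (by fun_prop)) fun x => hC x y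

lemma cpow_add_one_mul {x : ℝ} (hx : 0 < x) (ν a : ℂ) :
    (x : ℂ) ^ (ν + 1) * a = (x : ℂ) ^ ν * (x * a) := by
  rw [Complex.cpow_add _ _ (by exact_mod_cast hx.ne'), Complex.cpow_one, mul_assoc]

lemma hasDerivAt_kernelTransform {ν : ℂ} (hν : -1 < ν.re) {g K : ℝ → ℂ} (hg : IsHalfSchwartz g)
    (hK : HasLinearGrowth K) (y : ℝ) :
    HasDerivAt (kernelTransform ν g K) (kernelTransform (ν + 1) g (deriv K) y) y := by
  obtain ⟨C, hC0, hC⟩ := hK.deriv.exists_norm_comp_mul_le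
  have hbound : IntegrableOn (fun x : ℝ => (x : ℂ) ^ ν *
      ((x * g x) * ((C * (2 + |y|) * (1 + x) : ℝ) : ℂ))) (Ioi 0) := by
    refine integrableOn_cpow_mul_mul hν hg.id_mul (by fun_prop) (C := C * (2 + |y|))
      fun x hx => le_of_eq ?_
    rw [Complex.norm_real, Real.norm_of_nonneg (by positivity)]
  have key := (hasDerivAt_integral_of_dominated_loc_of_deriv_le (𝕜 := ℝ)
    (μ := volume.restrict (Ioi (0 : ℝ)))
    (F := fun y x => (x : ℂ) ^ ν * (g x * K (x * y)))
    (F' := fun y x => (x : ℂ) ^ ν * (g x * (x * deriv K (x * y))))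
    (Metric.ball_mem_nhds y one_pos)
    (.of_forall fun y => (integrableOn_kernelTransform hν hg hK y).aestronglyMeasurable)
    (integrableOn_kernelTransform hν hg hK y) ?_ ?_ hbound.norm ?_).2
  · refine key.congr_deriv (setIntegral_congr_fun measurableSet_Ioi fun x hx => ?_)
    rw [cpow_add_one_mul hx]
    ring
  · refine (integrableOn_kernelTransform hν hg.id_mul hK.deriv y).aestronglyMeasurable.congr
      (.of_forall fun x => ?_)
    simp only
    ring
  · refine (ae_restrict_mem measurableSet_Ioi).mono fun x hx z hz => ?_
    have hx0 : (0 : ℝ) < x := hx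
    have hzy : |z| ≤ |y| + 1 := by
      have h1 : |z - y| < 1 := by simpa [Real.dist_eq] using hz
      have h2 := abs_add_le (z - y) y
      rw [sub_add_cancel] at h2
      linarith
    have hle : ‖deriv K (x * z)‖ ≤ ‖((C * (2 + |y|) * (1 + x) : ℝ) : ℂ)‖ := by
      rw [Complex.norm_real, Real.norm_of_nonneg (by positivity)]
      refine (hC x z hx0.le).trans ?_
      gcongr ?_ * (1 + x)
      exact mul_le_mul_of_nonneg_left (by linarith) hC0
    rw [show (x : ℂ) ^ ν * (g x * (x * deriv K (x * z))) =
      (x : ℂ) ^ ν * ((x * g x) * deriv K (x * z)) by ring]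
    refine (norm_mul_le_of_le le_rfl (norm_mul_le_of_le le_rfl hle)).trans_eq ?_
    simp only [norm_mul]
  · refine .of_forall fun x z _ => ?_
    have h := ((contDiff_infty_iff_deriv.1 hK.1).1 (x * z)).hasDerivAt.scomp z
      ((hasDerivAt_id z).const_mul x)
    simpa using (h.const_mul (g x)).const_mul ((x : ℂ) ^ ν)

lemma iteratedDeriv_kernelTransform {ν : ℂ} (hν : -1 < ν.re) {g K : ℝ → ℂ}
    (hg : IsHalfSchwartz g) (hK : HasLinearGrowth K) (n : ℕ) :
    iteratedDeriv n (kernelTransform ν g K) =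
      kernelTransform (ν + n) g (iteratedDeriv n K) := by
  induction n with
  | zero => simp
  | succ n ih =>
    funext y
    rw [iteratedDeriv_succ, ih,
      (hasDerivAt_kernelTransform (re_add_natCast_gt hν n) hg (hK.iteratedDeriv n) y).deriv,
      iteratedDeriv_succ]
    push_cast
    rw [add_assoc]

lemma contDiff_kernelTransform {ν : ℂ} (hν : -1 < ν.re) {g K : ℝ → ℂ} (hg : IsHalfSchwartz g)
    (hK : HasLinearGrowth K) : ContDiff ℝ (⊤ : ℕ∞) (kernelTransform ν g K) := by
  refine contDiff_of_differentiable_iteratedDeriv fun n _ y => ?_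
  rw [iteratedDeriv_kernelTransform hν hg hK]
  exact (hasDerivAt_kernelTransform (re_add_natCast_gt hν n) hg
    (hK.iteratedDeriv n) y).differentiableAt

/-- A smooth function with linearly growing derivatives which agrees with `besselClifford ν` on
`[0, ∞)`. -/
noncomputable def besselCutoff (ν : ℂ) (t : ℝ) : ℂ :=
  (Real.smoothTransition (t + 1) : ℂ) * besselClifford ν t

lemma besselCutoff_of_nonneg (ν : ℂ) {t : ℝ} (ht : 0 ≤ t) :
    besselCutoff ν t = besselClifford ν t := by
  simp [besselCutoff, Real.smoothTransition.one_of_one_le (by linarith : 1 ≤ t + 1)]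

lemma iteratedDeriv_besselCutoff {ν : ℂ} (hν : -1 < ν.re) (n : ℕ) {t : ℝ} (ht : 0 < t) :
    iteratedDeriv n (besselCutoff ν) t = (-1) ^ n * besselClifford (ν + n) t := by
  have : besselCutoff ν =ᶠ[nhds t] besselClifford ν := by
    filter_upwards [Ioi_mem_nhds ht] with s hs using besselCutoff_of_nonneg ν (le_of_lt hs)
  rw [this.iteratedDeriv_eq, iteratedDeriv_besselClifford hν]

lemma hasLinearGrowth_besselCutoff {ν : ℂ} (hν : -1 < ν.re) :
    HasLinearGrowth (besselCutoff ν) := by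
  have hsmooth : ContDiff ℝ (⊤ : ℕ∞) (besselCutoff ν) :=
    (Complex.ofRealCLM.contDiff.comp
      (Real.smoothTransition.contDiff.comp (contDiff_id.add contDiff_const))).mul
      (contDiff_besselClifford hν)
  refine ⟨hsmooth, fun n => ?_⟩
  obtain ⟨C, hC0, hC⟩ := norm_besselClifford_le (re_add_natCast_gt hν n)
  obtain ⟨M, hM⟩ := isCompact_Icc.exists_bound_of_continuousOn (s := Set.Icc (-1 : ℝ) 0)
    (hsmooth.continuous_iteratedDeriv n (by exact_mod_cast le_top)).continuousOn
  have hM0 : 0 ≤ M := (norm_nonneg _).trans (hM 0 (by simp))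
  refine ⟨C + M, fun t => ?_⟩
  have ht0 := abs_nonneg t
  rcases lt_or_ge 0 t with ht | ht
  · rw [iteratedDeriv_besselCutoff hν n ht, norm_mul, norm_pow, norm_neg, norm_one, one_pow,
      one_mul]
    refine (hC t ht.le).trans ?_
    rw [abs_of_pos ht]
    gcongr
    linarith
  · rcases lt_or_ge t (-1) with ht1 | ht1
    · have : besselCutoff ν =ᶠ[nhds t] fun _ => 0 := by
        filter_upwards [Iio_mem_nhds ht1] with s hs
        have hs' : s < -1 := hs
        simp [besselCutoff,
          Real.smoothTransition.zero_of_nonpos (by linarith : s + 1 ≤ 0)]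
      rw [this.iteratedDeriv_eq, iteratedDeriv_const]
      simp only [ite_self, norm_zero]
      positivity
    · refine (hM t ⟨ht1, ht⟩).trans ?_
      nlinarith [mul_nonneg hC0 ht0, mul_nonneg hM0 ht0]

lemma kernelTransform_iteratedDeriv_besselCutoff {ν : ℂ} (hν : -1 < ν.re) (μ : ℂ) (g : ℝ → ℂ)
    (n : ℕ) {y : ℝ} (hy : 0 < y) : kernelTransform μ g (iteratedDeriv n (besselCutoff ν)) y =
      (-1) ^ n * kernelTransform μ g (besselClifford (ν + n)) y := by
  rw [kernelTransform, kernelTransform, ← integral_const_mul]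
  refine setIntegral_congr_fun measurableSet_Ioi fun x hx => ?_
  rw [iteratedDeriv_besselCutoff hν n (mul_pos hx hy)]
  ring

lemma continuous_besselClifford_comp {ν : ℂ} (hν : -1 < ν.re) (y : ℝ) :
    Continuous fun x : ℝ => besselClifford ν (x * y) :=
  (differentiable_besselClifford hν).continuous.comp (by fun_prop)

lemma norm_besselClifford_mul_le {ν : ℂ} (hν : -1 < ν.re) : ∃ C : ℝ, 0 ≤ C ∧
    ∀ x y : ℝ, 0 ≤ x → 1 ≤ y → ‖besselClifford ν (x * y)‖ ≤ C * y * (1 + x) := by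
  obtain ⟨C, hC0, hC⟩ := norm_besselClifford_le hν
  refine ⟨C, hC0, fun x y hx hy => (hC _ (by positivity)).trans ?_⟩
  rw [mul_assoc]
  gcongr
  nlinarith

/-- Integration of a total derivative against the weight `x ^ ν`. -/
lemma integral_cpow_mul_deriv_eq_zero {ν : ℂ} (hν : -1 < ν.re) {g K K' : ℝ → ℂ}
    (hg : IsHalfSchwartz g) (hK : ∀ x, HasDerivAt K (K' x) x) (hK' : Continuous K') {C : ℝ}
    (hKC : ∀ x, 0 ≤ x → ‖K x‖ ≤ C * (1 + x)) (hKC' : ∀ x, 0 ≤ x → ‖K' x‖ ≤ C * (1 + x)) :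
    ∫ x in Ioi (0 : ℝ), (x : ℂ) ^ ν *
      ((ν + 1) * g x * K x + x * deriv g x * K x + x * g x * K' x) = 0 := by
  have hν1 := add_one_ne_zero_of_re hν
  have hKcont : Continuous K := continuous_iff_continuousAt.2 fun x => (hK x).continuousAt
  have hC : 0 ≤ C := by simpa using (norm_nonneg _).trans (hKC 0 le_rfl)
  have hcpow : Continuous fun x : ℝ => (x : ℂ) ^ (ν + 1) :=
    Complex.continuous_ofReal_cpow_const (by simp; linarith)
  have h := integral_Ioi_of_hasDerivAt_of_tendsto (a := 0) (m := 0)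
    (f := fun x : ℝ => (x : ℂ) ^ (ν + 1) * (g x * K x))
    (f' := fun x : ℝ => (x : ℂ) ^ ν *
      ((ν + 1) * g x * K x + x * deriv g x * K x + x * g x * K' x))
    (hcpow.mul (hg.continuous.mul hKcont)).continuousWithinAt (fun x hx => ?_) ?_ ?_
  · simpa [Complex.zero_cpow hν1] using h
  · have hx0 : (0 : ℝ) < x := hx
    refine ((hasDerivAt_ofReal_cpow_const hx0.ne' hν1).mul
      ((hg.hasDerivAt x).mul (hK x))).congr_deriv ?_
    rw [cpow_add_one_mul hx0, add_sub_cancel_right, Pi.mul_apply]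
    ring
  · refine (((integrableOn_cpow_mul_mul hν (hg.const_mul (ν + 1)) hKcont hKC).add
      (integrableOn_cpow_mul_mul hν hg.deriv.id_mul hKcont hKC)).add
      (integrableOn_cpow_mul_mul hν hg.id_mul hK' hKC')).congr (.of_forall fun x => ?_)
    simp only [Pi.add_apply]
    ring
  · obtain ⟨m, hm⟩ := exists_nat_ge (ν.re + 3)
    obtain ⟨D, hD⟩ := hg.2 m 0
    refine squeeze_zero_norm' (a := fun x : ℝ => D * (C * 2) * x⁻¹) ?_
      (by simpa using tendsto_inv_atTop_zero.const_mul (D * (C * 2)))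
    filter_upwards [Filter.eventually_ge_atTop 1] with x hx
    have hx0 : 0 < x := by linarith
    have h1 : x ^ m * ‖g x‖ ≤ D := by simpa using hD x hx
    have h2 : ‖K x‖ ≤ C * 2 * x := (hKC x hx0.le).trans (by nlinarith)
    have h3 : x ^ (ν.re + 1) * x * x ≤ x ^ m := by
      rw [← Real.rpow_natCast x m, ← Real.rpow_add_one hx0.ne', ← Real.rpow_add_one hx0.ne']
      exact Real.rpow_le_rpow_of_exponent_le hx (by linarith)
    rw [← div_eq_mul_inv, le_div_iff₀ hx0, norm_mul, norm_mul,
      Complex.norm_cpow_eq_rpow_re_of_pos hx0]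
    simp only [Complex.add_re, Complex.one_re]
    calc x ^ (ν.re + 1) * (‖g x‖ * ‖K x‖) * x
        ≤ x ^ (ν.re + 1) * (‖g x‖ * (C * 2 * x)) * x := by gcongr
      _ = (x ^ (ν.re + 1) * x * x) * ‖g x‖ * (C * 2) := by ring
      _ ≤ x ^ m * ‖g x‖ * (C * 2) := by gcongr
      _ ≤ D * (C * 2) := by gcongr

/-- Multiplication by `y` corresponds to the operator `-(x ∂² + (ν + 1) ∂)`. -/
lemma mul_kernelTransform_besselClifford {ν : ℂ} (hν : -1 < ν.re) {g : ℝ → ℂ}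
    (hg : IsHalfSchwartz g) {y : ℝ} (hy : 1 ≤ y) :
    y * kernelTransform ν g (besselClifford ν) y =
      -kernelTransform ν (fun x => (ν + 1) * deriv g x + x * deriv (deriv g) x)
        (besselClifford ν) y := by
  have h1 : -1 < (ν + 1).re := by simp; linarith
  have h2 : -1 < (ν + 1 + 1).re := by simp; linarith
  have hderiv {μ : ℂ} (hμ : -1 < μ.re) (x : ℝ) : HasDerivAt (fun x => besselClifford μ (x * y))
      (-y * besselClifford (μ + 1) (x * y)) x := by
    have := (hasDerivAt_besselClifford hμ (x * y)).scomp x ((hasDerivAt_id x).mul_const y)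
    refine this.congr_deriv ?_
    simp
  obtain ⟨C₀, hC₀, b₀⟩ := norm_besselClifford_mul_le hν
  obtain ⟨C₁, hC₁, b₁⟩ := norm_besselClifford_mul_le h1
  obtain ⟨C₂, hC₂, b₂⟩ := norm_besselClifford_mul_le h2
  have c₀ := continuous_besselClifford_comp hν y
  have c₁ := continuous_besselClifford_comp h1 y
  have c₂ := continuous_besselClifford_comp h2 y
  set C : ℝ := (C₀ + C₁ + C₂) * y * y
  have hle {c x : ℝ} {z : ℂ} (hc : 0 ≤ c) (hc' : c ≤ C₀ + C₁ + C₂) (hx : 0 ≤ x)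
      (hz : ‖z‖ ≤ c * y * (1 + x)) : ‖z‖ ≤ C * (1 + x) ∧ ‖-y * z‖ ≤ C * (1 + x) := by
    have hs : 0 ≤ C₀ + C₁ + C₂ := by positivity
    have h3 : ‖z‖ ≤ (C₀ + C₁ + C₂) * y * (1 + x) := hz.trans (by gcongr)
    have h4 : y * ‖z‖ ≤ C * (1 + x) :=
      (mul_le_mul_of_nonneg_left h3 (by linarith)).trans (le_of_eq (by simp only [C]; ring))
    refine ⟨le_trans ?_ h4, ?_⟩
    · exact le_mul_of_one_le_left (norm_nonneg _) hy
    · rw [norm_mul, norm_neg, Complex.norm_real, Real.norm_of_nonneg (by linarith)]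
      exact h4
  have l₀ (x : ℝ) (hx : 0 ≤ x) := hle hC₀ (by linarith) hx (b₀ x y hx hy)
  have l₁ (x : ℝ) (hx : 0 ≤ x) := hle hC₁ (by linarith) hx (b₁ x y hx hy)
  have l₂ (x : ℝ) (hx : 0 ≤ x) := hle hC₂ (by linarith) hx (b₂ x y hx hy)
  have A := integral_cpow_mul_deriv_eq_zero hν hg (hderiv h1) (by fun_prop)
    (fun x hx => (l₁ x hx).1) (fun x hx => (l₂ x hx).2)
  have B := integral_cpow_mul_deriv_eq_zero hν hg.deriv (hderiv hν) (by fun_prop)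
    (fun x hx => (l₀ x hx).1) (fun x hx => (l₁ x hx).2)
  have i₀ := integrableOn_cpow_mul_mul hν hg c₀ fun x hx => (l₀ x hx).1
  have i₁ := integrableOn_cpow_mul_mul hν hg.deriv.id_mul c₁ fun x hx => (l₁ x hx).1
  have i₂ := integrableOn_cpow_mul_mul hν
    ((hg.deriv.const_mul (ν + 1)).add hg.deriv.deriv.id_mul) c₀ fun x hx => (l₀ x hx).1
  have A' : kernelTransform ν g (besselClifford ν) y +
      ∫ x in Ioi (0 : ℝ), (x : ℂ) ^ ν * (x * deriv g x * besselClifford (ν + 1) (x * y)) = 0 := by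
    rw [kernelTransform, ← integral_add i₀ i₁, ← A]
    refine integral_congr_ae (.of_forall fun x => ?_)
    simp only
    rw [← besselClifford_recurrence hν (x * y)]
    push_cast
    ring
  have B' : kernelTransform ν (fun x => (ν + 1) * deriv g x + x * deriv (deriv g) x)
      (besselClifford ν) y -
      y * ∫ x in Ioi (0 : ℝ), (x : ℂ) ^ ν * (x * deriv g x * besselClifford (ν + 1) (x * y)) =
        0 := by
    rw [kernelTransform, ← integral_const_mul, ← integral_sub i₂ (i₁.const_mul _), ← B]
    refine integral_congr_ae (.of_forall fun x => ?_)
    simp only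
    ring
  linear_combination y * A' + B'

lemma exists_pow_mul_norm_kernelTransform_le {ν : ℂ} (hν : -1 < ν.re) {g : ℝ → ℂ}
    (hg : IsHalfSchwartz g) (m : ℕ) : ∃ C : ℝ, ∀ y : ℝ, 1 ≤ y →
      y ^ m * ‖kernelTransform ν g (besselClifford ν) y‖ ≤ C * y := by
  induction m generalizing g with
  | zero =>
    obtain ⟨C, hC0, hC⟩ := norm_besselClifford_mul_le hν
    have hint := (integrableOn_cpow_mul_mul hν hg (K := fun x : ℝ => ((C * (1 + x) : ℝ) : ℂ))
      (by fun_prop) (C := C) fun x hx => le_of_eq (by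
        rw [Complex.norm_real, Real.norm_of_nonneg (by positivity)])).norm
    refine ⟨∫ x in Ioi (0 : ℝ), ‖(x : ℂ) ^ ν * (g x * ((C * (1 + x) : ℝ) : ℂ))‖,
      fun y hy => ?_⟩
    rw [pow_zero, one_mul, ← integral_mul_const]
    refine norm_integral_le_of_norm_le (hint.mul_const y)
      ((ae_restrict_mem measurableSet_Ioi).mono fun x hx => ?_)
    have hx0 : (0 : ℝ) ≤ x := le_of_lt hx
    simp only [norm_mul, Complex.norm_real]
    rw [Real.norm_of_nonneg (by positivity : 0 ≤ C), Real.norm_of_nonneg (by positivity : 0 ≤ 1 + x),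
      mul_assoc, mul_assoc ‖g x‖]
    gcongr
    exact (hC x y hx0 hy).trans (le_of_eq (by ring))
  | succ m ih =>
    obtain ⟨C, hC⟩ := ih ((hg.deriv.const_mul (ν + 1)).add hg.deriv.deriv.id_mul)
    refine ⟨C, fun y hy => le_trans (le_of_eq ?_) (hC y hy)⟩
    have h := congrArg norm (mul_kernelTransform_besselClifford hν hg hy)
    rw [norm_neg, norm_mul, Complex.norm_real, Real.norm_of_nonneg (by linarith)] at h
    rw [← h]
    ring

/-- The kernel transform with the cut-off Bessel–Clifford kernel preserves `S([0,∞))`. -/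
lemma IsHalfSchwartz.kernelTransform_besselCutoff {ν : ℂ} (hν : -1 < ν.re) {g : ℝ → ℂ}
    (hg : IsHalfSchwartz g) : IsHalfSchwartz (kernelTransform ν g (besselCutoff ν)) := by
  have hK := hasLinearGrowth_besselCutoff hν
  refine ⟨contDiff_kernelTransform hν hg hK, fun m n => ?_⟩
  obtain ⟨C, hC⟩ :=
    exists_pow_mul_norm_kernelTransform_le (re_add_natCast_gt hν n) hg (m + 1)
  refine ⟨C, fun y hy => ?_⟩
  have hy0 : 0 < y := by linarith
  rw [iteratedDeriv_kernelTransform hν hg hK,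
    kernelTransform_iteratedDeriv_besselCutoff hν _ g n hy0, norm_mul, norm_pow, norm_neg,
    norm_one, one_pow, one_mul]
  have := hC y hy
  rw [pow_succ, mul_right_comm] at this
  exact le_of_mul_le_mul_right this hy0

lemma besselJ_two_mul (ν : ℂ) {s : ℝ} (hs : 0 < s) :
    besselJ ν (2 * s) = (s : ℂ) ^ ν * besselClifford ν (s ^ 2) := by
  have hs' : (s : ℂ) ≠ 0 := by exact_mod_cast hs.ne'
  rw [besselJ, besselClifford, ← tsum_mul_left]
  refine tsum_congr fun k => ?_
  rw [mul_div_cancel_left₀ s two_ne_zero, Complex.cpow_add _ _ hs', Complex.Gamma_nat_eq_factorial,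
    show (2 : ℂ) * k = ((2 * k : ℕ) : ℂ) by push_cast; ring, Complex.cpow_natCast, pow_mul]
  push_cast
  rw [neg_pow ((s : ℂ) ^ 2)]
  ring

lemma cpow_half_mul_hankel_integrand (ν c : ℂ) {x y : ℝ} (hx : 0 < x) (hy : 0 < y) :
    (x : ℂ) ^ ((ν + 1) / 2) * c * (Real.sqrt (x * y) : ℂ) * besselJ ν (2 * Real.sqrt (x * y)) /
      (x : ℂ) = (y : ℂ) ^ ((ν + 1) / 2) * ((x : ℂ) ^ ν * (c * besselClifford ν (x * y))) := by
  have hhalf {a : ℝ} (ha : 0 < a) : ((a ^ 2 : ℝ) : ℂ) ^ ((ν + 1) / 2) = (a : ℂ) ^ ν * a := by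
    have ha' : (a : ℂ) ≠ 0 := by exact_mod_cast ha.ne'
    rw [pow_two, Complex.ofReal_mul, Complex.mul_cpow_ofReal_nonneg ha.le ha.le,
      ← Complex.cpow_add _ _ ha', add_halves, Complex.cpow_add _ _ ha', Complex.cpow_one]
  obtain ⟨a, ha, rfl⟩ : ∃ a : ℝ, 0 < a ∧ x = a ^ 2 :=
    ⟨√x, Real.sqrt_pos.2 hx, (Real.sq_sqrt hx.le).symm⟩
  obtain ⟨b, hb, rfl⟩ : ∃ b : ℝ, 0 < b ∧ y = b ^ 2 :=
    ⟨√y, Real.sqrt_pos.2 hy, (Real.sq_sqrt hy.le).symm⟩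
  have ha' : (a : ℂ) ≠ 0 := by exact_mod_cast ha.ne'
  rw [← mul_pow, Real.sqrt_sq (by positivity), besselJ_two_mul ν (by positivity), hhalf ha,
    hhalf hb, pow_two a]
  simp only [Complex.ofReal_mul, Complex.mul_cpow_ofReal_nonneg ha.le ha.le,
    Complex.mul_cpow_ofReal_nonneg ha.le hb.le]
  field_simp

/-- for `Re ν > -1`, the Hankel transform `H_ν` maps `S_ν([0,∞))` into
itself. (Note `hankel ν f y = 0` for `y ≤ 0`, so in particular `H_ν(f)(0) = 0`.) -/
theorem hankel_maps_Snu_to_Snu (ν : ℂ) (hν : -1 < ν.re) (f : ℝ → ℂ) (hf : MemSnu ν f) :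
    MemSnu ν (hankel ν f) := by
  obtain ⟨f₁, ⟨g, hg, hfg, hdecay⟩, hf⟩ := hf
  have hG := IsHalfSchwartz.kernelTransform_besselCutoff hν (g := g) ⟨hg, hdecay⟩
  refine ⟨_, ⟨_, hG.1, fun _ _ => rfl, hG.2⟩, fun y hy => ?_⟩
  rcases hy.eq_or_lt with rfl | hy
  · have : (ν + 1) / 2 ≠ 0 := div_ne_zero (add_one_ne_zero_of_re hν) two_ne_zero
    simp [hankel, Complex.zero_cpow this]
  · rw [hankel, kernelTransform, ← integral_const_mul]
    refine setIntegral_congr_fun measurableSet_Ioi fun x hx => ?_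
    have hx0 : (0 : ℝ) < x := hx
    rw [hf x hx0.le, hfg x hx0.le, cpow_half_mul_hankel_integrand ν _ hx0 hy,
      besselCutoff_of_nonneg ν (by positivity)]
end
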